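/- Let A be an essential central arrangement, X_1,…,X_s pairwise distinct rank-2 flats of A, and r_1 ∈ F(A_{X_1}),…, r_s ∈ F(A_{X_s}) nonzero relations. If L_1 ∂(r_1) + ⋯ + L_s ∂(r_s) = 0 with every L_i a nonzero linear form in K[y_1,…,y_d], then for every i the support of L_i (the set of variables appearing with nonzero coefficient in L_i) is disjoint from the support of r_i. -/

import Mathlib

open MvPolynomial

/-- An essential central arrangement of hyperplanes in `K^n`, with hyperplanes indexed by `ι`:
the hyperplane `H i` is the kernel of the nonzero linear form with coefficient vector `form i`,
the forms are pairwise non-proportional (the hyperplanes are distinct), and they span the dual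
space (the arrangement is essential, i.e. has rank `n`). -/
structure CentralArrangement (K : Type*) [Field K] (ι : Type*) [Fintype ι] (n : ℕ) where
  form : ι → (Fin n → K)
  nonzero : ∀ i, form i ≠ 0
  nonProportional : ∀ i j, i ≠ j → ∀ t : K, form i ≠ t • form j
  essential : Submodule.span K (Set.range form) = ⊤

namespace CentralArrangement

variable {K : Type*} [Field K] {ι : Type*} [Fintype ι] {n : ℕ}

/-- The evaluation map `K^ι → K[x_1,…,x_n]_1 ≅ K^n`, sending `e i` to the form `α i`. -/
noncomputable def evalMap (A : CentralArrangement K ι n) : (ι → K) →ₗ[K] (Fin n → K) where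
  toFun c := ∑ i, c i • A.form i
  map_add' x y := by
    simp [add_smul, Finset.sum_add_distrib]
  map_smul' t x := by
    simp [smul_smul, Finset.smul_sum]

/-- The relation space `F(A)`: the kernel of the evaluation map. -/
noncomputable def relSpace (A : CentralArrangement K ι n) : Submodule K (ι → K) :=
  LinearMap.ker A.evalMap

end CentralArrangement

open Classical in
/-- The support of a vector `c : ι → K`, as a finset. -/
noncomputable def vsupp {K ι : Type*} [Field K] [Fintype ι] (c : ι → K) : Finset ι :=
  Finset.univ.filter fun j => c j ≠ 0

/-- The Orlik-Terao boundary `∂(c) = Σ_{j ∈ Λ} c_j · Π_{l ∈ Λ, l ≠ j} y_l`, where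
`Λ` is the support of the dependency `c`. -/
noncomputable def otgen {K ι : Type*} [Field K] [Fintype ι] [DecidableEq ι] (c : ι → K) :
    MvPolynomial ι K :=
  ∑ j ∈ vsupp c, MvPolynomial.C (c j) * ∏ l ∈ (vsupp c).erase j, MvPolynomial.X l

namespace CentralArrangement

variable {K : Type*} [Field K] {ι : Type*} [Fintype ι] [DecidableEq ι] {n : ℕ}

/-- The Orlik-Terao ideal `I`, generated by `∂(c)` for all relations `c ∈ F(A)`. -/
noncomputable def otIdeal (A : CentralArrangement K ι n) : Ideal (MvPolynomial ι K) :=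
  Ideal.span (otgen '' (A.relSpace : Set (ι → K)))

/-- The quadratic component `I₂` of the Orlik-Terao ideal: the ideal generated by the
degree-2 (homogeneous) elements of `I`. -/
noncomputable def otQuadratic (A : CentralArrangement K ι n) : Ideal (MvPolynomial ι K) :=
  Ideal.span {f | f ∈ A.otIdeal ∧ f.IsHomogeneous 2}

/-- A 3-relation is an element of `F(A)` with support of size 3; the arrangement is
2-formal if the 3-relations span the relation space. -/
def IsTwoFormal (A : CentralArrangement K ι n) : Prop :=
  Submodule.span K {c : ι → K | c ∈ A.relSpace ∧ (vsupp c).card = 3} = A.relSpace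

end CentralArrangement
namespace CentralArrangement

variable {K : Type*} [Field K] {ι : Type*} [Fintype ι] {n : ℕ}

/-- A rank-2 flat `X ∈ L_2(A)`, encoded by the set `S = {i | X ⊆ H_i}` of hyperplanes
containing it: the forms indexed by `S` span a plane, and `S` is closed. -/
def IsRankTwoFlat (A : CentralArrangement K ι n) (S : Set ι) : Prop :=
  Module.finrank K ↥(Submodule.span K (A.form '' S)) = 2 ∧
  ∀ j, A.form j ∈ Submodule.span K (A.form '' S) → j ∈ S

/-- Membership in `F(A_X)`: a relation supported on the hyperplanes containing the flat. -/
def MemFlatRel (A : CentralArrangement K ι n) (S : Set ι) (c : ι → K) : Prop :=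
  c ∈ A.relSpace ∧ ∀ i, c i ≠ 0 → i ∈ S

end CentralArrangement


open MvPolynomial

/-- The exponent of the squarefree monomial with variables in `T`. -/
noncomputable def squarefreeExp {ι : Type*} (T : Finset ι) : ι →₀ ℕ :=
  ∑ i ∈ T, Finsupp.single i 1

theorem squarefreeExp_apply {ι : Type*} [DecidableEq ι] (T : Finset ι) (i : ι) :
    squarefreeExp T i = if i ∈ T then 1 else 0 := by
  simp [squarefreeExp, Finsupp.finsetSum_apply, Finsupp.single_apply]

theorem squarefreeExp_injective {ι : Type*} :
    Function.Injective (squarefreeExp : Finset ι → ι →₀ ℕ) := by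
  classical
  intro S T h
  ext i
  have hi := DFunLike.congr_fun h i
  simp only [squarefreeExp_apply] at hi
  split_ifs at hi <;> simp_all

theorem mem_vsupp {K ι : Type*} [Field K] [Fintype ι] {c : ι → K} {i : ι} :
    i ∈ vsupp c ↔ c i ≠ 0 := by
  simp [vsupp]

section Coefficients

variable {K ι : Type*} [Field K] [Fintype ι] [DecidableEq ι]

theorem coeff_otgen (c : ι → K) (v : ι →₀ ℕ) :
    coeff v (otgen c) =
      ∑ l ∈ vsupp c, if squarefreeExp ((vsupp c).erase l) = v then c l else 0 := by
  have h (T : Finset ι) : ∏ i ∈ T, (X i : MvPolynomial ι K) = monomial (squarefreeExp T) 1 := by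
    rw [squarefreeExp, monomial_sum_one]
    rfl
  simp [otgen, coeff_sum, h, coeff_C_mul, coeff_monomial]

theorem exists_of_coeff_otgen_ne_zero {c : ι → K} {v : ι →₀ ℕ} (h : coeff v (otgen c) ≠ 0) :
    ∃ l ∈ vsupp c, v = squarefreeExp ((vsupp c).erase l) := by
  rw [coeff_otgen] at h
  obtain ⟨l, hl, hne⟩ := Finset.exists_ne_zero_of_sum_ne_zero h
  exact ⟨l, hl, by_contra fun hv => hne (if_neg fun h' => hv h'.symm)⟩

theorem coeff_otgen_erase {c : ι → K} {l : ι} (hl : l ∈ vsupp c) :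
    coeff (squarefreeExp ((vsupp c).erase l)) (otgen c) = c l := by
  rw [coeff_otgen, Finset.sum_eq_single_of_mem l hl, if_pos rfl]
  intro b hb hbl
  refine if_neg fun h => hbl ?_
  by_contra hne
  have : b ∈ (vsupp c).erase b := by
    rw [squarefreeExp_injective h]
    exact Finset.mem_erase.2 ⟨hbl, hb⟩
  simp at this

theorem factors_of_coeff_ne_zero {L : MvPolynomial ι K} (hL : L.IsHomogeneous 1) {c : ι → K}
    {T : Finset ι} {j : ι} (hj : j ∈ T) {u v : ι →₀ ℕ}
    (huv : u + v = Finsupp.single j 1 + squarefreeExp T)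
    (hu : coeff u L ≠ 0) (hv : coeff v (otgen c) ≠ 0) :
    u = Finsupp.single j 1 ∧ ∃ l ∈ vsupp c, T = (vsupp c).erase l := by
  obtain ⟨l, hl, rfl⟩ := exists_of_coeff_otgen_ne_zero hv
  have hdeg : u.degree = 1 := by_contra fun h => hu (hL.coeff_eq_zero h)
  obtain ⟨i, rfl⟩ := (Finsupp.sum_eq_one_iff u).1 hdeg
  have hij : i = j := by
    by_contra hne
    have h := DFunLike.congr_fun huv j
    simp only [Finsupp.add_apply, squarefreeExp_apply, Finsupp.single_apply, if_pos hj,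
      if_neg hne, if_true] at h
    split_ifs at h <;> omega
  subst hij
  exact ⟨rfl, l, hl, squarefreeExp_injective (add_left_cancel huv).symm⟩

theorem coeff_mul_otgen_erase {L : MvPolynomial ι K} (hL : L.IsHomogeneous 1) {c : ι → K}
    {j l : ι} (hj : j ∈ (vsupp c).erase l) (hl : l ∈ vsupp c) :
    coeff (Finsupp.single j 1 + squarefreeExp ((vsupp c).erase l)) (L * otgen c) =
      coeff (Finsupp.single j 1) L * c l := by
  rw [coeff_mul, Finset.sum_eq_single_of_mem
    (Finsupp.single j 1, squarefreeExp ((vsupp c).erase l)) (by simp), coeff_otgen_erase hl]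
  rintro ⟨u, v⟩ huv hne
  rw [Finset.HasAntidiagonal.mem_antidiagonal] at huv
  by_contra h
  obtain ⟨rfl, -⟩ := factors_of_coeff_ne_zero hL hj huv (left_ne_zero_of_mul h)
    (right_ne_zero_of_mul h)
  exact hne (Prod.ext rfl (add_left_cancel huv))

theorem coeff_mul_otgen_eq_zero {L : MvPolynomial ι K} (hL : L.IsHomogeneous 1) {c : ι → K}
    {T : Finset ι} {j : ι} (hj : j ∈ T) (hT : ¬ T ⊆ vsupp c) :
    coeff (Finsupp.single j 1 + squarefreeExp T) (L * otgen c) = 0 := by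
  rw [coeff_mul]
  refine Finset.sum_eq_zero fun p hp => ?_
  by_contra h
  obtain ⟨-, l, -, rfl⟩ := factors_of_coeff_ne_zero hL hj (Finset.HasAntidiagonal.mem_antidiagonal.1 hp)
    (left_ne_zero_of_mul h) (right_ne_zero_of_mul h)
  exact hT (Finset.erase_subset _ _)

end Coefficients

namespace CentralArrangement

variable {K : Type*} [Field K] {ι : Type*} [Fintype ι] {n : ℕ} (A : CentralArrangement K ι n)

theorem linearIndependent_pair {i j : ι} (hij : i ≠ j) :
    LinearIndependent K ![A.form i, A.form j] := by
  rw [LinearIndependent.pair_iff' (A.nonzero i)]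
  exact fun t h => A.nonProportional j i hij.symm t h.symm

/-- The support of a nonzero relation has at least three elements. -/
theorem two_lt_card_vsupp {c : ι → K} (hc : c ∈ A.relSpace) (hc0 : c ≠ 0) :
    2 < (vsupp c).card := by
  classical
  have hsum : ∑ i ∈ vsupp c, c i • A.form i = 0 := by
    rw [← show ∑ i, c i • A.form i = 0 from hc]
    refine Finset.sum_subset (Finset.subset_univ _) fun i _ hi => ?_
    rw [mem_vsupp, not_not] at hi
    rw [hi, zero_smul]
  obtain ⟨i, hi⟩ := Function.ne_iff.1 hc0
  have hi' : i ∈ vsupp c := mem_vsupp.2 hi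
  by_contra hcard
  obtain h | h | h : (vsupp c).card = 0 ∨ (vsupp c).card = 1 ∨ (vsupp c).card = 2 := by omega
  · simp [Finset.card_eq_zero.1 h] at hi'
  · obtain ⟨a, ha⟩ := Finset.card_eq_one.1 h
    have ha0 : c a ≠ 0 := mem_vsupp.1 (by simp [ha])
    rw [ha, Finset.sum_singleton] at hsum
    exact smul_ne_zero ha0 (A.nonzero a) hsum
  · obtain ⟨a, b, hab, hs⟩ := Finset.card_eq_two.1 h
    have ha0 : c a ≠ 0 := mem_vsupp.1 (by simp [hs])
    rw [hs, Finset.sum_pair hab] at hsum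
    exact ha0 (LinearIndependent.pair_iff.1 (A.linearIndependent_pair hab) _ _ hsum).1

variable {A}

/-- A rank-2 flat is determined by any two of its hyperplanes. -/
theorem IsRankTwoFlat.span_pair_eq {S : Set ι} (hS : A.IsRankTwoFlat S) {i j : ι} (hij : i ≠ j)
    (hi : i ∈ S) (hj : j ∈ S) :
    Submodule.span K {A.form i, A.form j} = Submodule.span K (A.form '' S) := by
  refine Submodule.eq_of_le_of_finrank_eq (Submodule.span_mono ?_) ?_
  · rintro _ (rfl | rfl)
    exacts [⟨i, hi, rfl⟩, ⟨j, hj, rfl⟩]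
  · have h := finrank_span_eq_card (A.linearIndependent_pair hij)
    rw [Matrix.range_cons_cons_empty, Fintype.card_fin] at h
    rw [h, hS.1]

theorem IsRankTwoFlat.eq_of_pair_mem {S T : Set ι} (hS : A.IsRankTwoFlat S)
    (hT : A.IsRankTwoFlat T) {i j : ι} (hij : i ≠ j) (hiS : i ∈ S) (hjS : j ∈ S)
    (hiT : i ∈ T) (hjT : j ∈ T) : S = T := by
  have h : Submodule.span K (A.form '' S) = Submodule.span K (A.form '' T) :=
    (hS.span_pair_eq hij hiS hjS).symm.trans (hT.span_pair_eq hij hiT hjT)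
  ext k
  constructor
  · exact fun hk => hT.2 k (h ▸ Submodule.subset_span ⟨k, hk, rfl⟩)
  · exact fun hk => hS.2 k (h ▸ Submodule.subset_span ⟨k, hk, rfl⟩)

end CentralArrangement

/-- Let `A` be an essential central arrangement, `X_1,…,X_s` pairwise
distinct rank-2 flats of `A`, and `r_1 ∈ F(A_{X_1}),…, r_s ∈ F(A_{X_s})` nonzero relations.
If `L_1 ∂(r_1) + ⋯ + L_s ∂(r_s) = 0` with every `L_i` a nonzero linear form, then for every
`i` the support of `L_i` (the variables occurring in `L_i`) is disjoint from the support of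
`r_i`. -/
theorem linear_syzygy_support_disjoint
    (K : Type*) [Field K] (d n s : ℕ)
    (A : CentralArrangement K (Fin d) n)
    (X : Fin s → Set (Fin d)) (hX : ∀ m, A.IsRankTwoFlat (X m))
    (hXinj : Function.Injective X)
    (r : Fin s → (Fin d → K)) (hr : ∀ m, A.MemFlatRel (X m) (r m))
    (hr0 : ∀ m, r m ≠ 0)
    (L : Fin s → MvPolynomial (Fin d) K)
    (hL1 : ∀ m, (L m).IsHomogeneous 1) (hL0 : ∀ m, L m ≠ 0)
    (hsyz : ∑ m, L m * otgen (r m) = 0) :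
    ∀ m, ∀ j : Fin d, coeff (Finsupp.single j 1) (L m) ≠ 0 → r m j = 0 := by
  intro m j hLj
  by_contra hj0
  have hj : j ∈ vsupp (r m) := mem_vsupp.2 hj0
  have hcard := A.two_lt_card_vsupp (hr m).1 (hr0 m)
  obtain ⟨l, hl, hlj⟩ := Finset.exists_mem_ne (s := vsupp (r m)) (by omega) j
  obtain ⟨k, hk, hkj⟩ := Finset.exists_mem_ne (s := (vsupp (r m)).erase l)
    (by rw [Finset.card_erase_of_mem hl]; omega) j
  have hjT : j ∈ (vsupp (r m)).erase l := Finset.mem_erase.2 ⟨hlj.symm, hj⟩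
  have hother (m' : Fin s) (hm' : m' ≠ m) : ¬ (vsupp (r m)).erase l ⊆ vsupp (r m') := by
    intro hsub
    refine hm' (hXinj ((hX m').eq_of_pair_mem (hX m) hkj ?_ ?_ ?_ ?_))
    · exact (hr m').2 k (mem_vsupp.1 (hsub hk))
    · exact (hr m').2 j (mem_vsupp.1 (hsub hjT))
    · exact (hr m).2 k (mem_vsupp.1 (Finset.mem_of_mem_erase hk))
    · exact (hr m).2 j hj0
  have hcoeff := congrArg
    (coeff (Finsupp.single j 1 + squarefreeExp ((vsupp (r m)).erase l))) hsyz
  rw [coeff_sum, coeff_zero, Finset.sum_eq_single_of_mem m (Finset.mem_univ m)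
    fun m' _ hm' => coeff_mul_otgen_eq_zero (hL1 m') hjT (hother m' hm'),
    coeff_mul_otgen_erase (hL1 m) hjT hl] at hcoeff
  exact mul_ne_zero hLj (mem_vsupp.1 hl) hcoeff
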